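/- For every n ≥ 3, every minimum edge dominating set of the pseudofractal scale-free web G_n contains, for each of the three hub vertices, at least one edge incident to that hub vertex. -/

import Mathlib

/-!
Common definitions: the pseudofractal scale-free web `pfw n` (= `G_n` for `n ≥ 1`)
and the Sierpinski graph `sierp n` (= `S_n` for `n ≥ 1`), together with the
edge-domination notions used in the paper.
-/

open scoped Classical

noncomputable section

/-- A finite graph generation: a finite vertex type, a finite set of edges
(unordered pairs of vertices), and three designated hub/outmost vertices. -/
structure GraphGen : Type 1 where
  V : Type
  fin : Fintype V
  edges : Finset (Sym2 V)
  hubs : Fin 3 → V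

attribute [instance] GraphGen.fin

/-- The triangle (complete graph on three vertices), the common first generation. -/
def triangle : GraphGen where
  V := Fin 3
  fin := inferInstance
  edges := {s((0 : Fin 3), (1 : Fin 3)), s((0 : Fin 3), (2 : Fin 3)), s((1 : Fin 3), (2 : Fin 3))}
  hubs := fun i => i

/-- One iteration step of the pseudofractal scale-free web: for every existing
edge `{u,v}` a new vertex is added and joined to both `u` and `v`. -/
def pfwStep (X : GraphGen) : GraphGen where
  V := X.V ⊕ {e : Sym2 X.V // e ∈ X.edges}
  fin := inferInstance
  edges :=
    X.edges.image (Sym2.map Sum.inl) ∪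
      X.edges.attach.biUnion fun e =>
        (Finset.univ.filter fun v : X.V => v ∈ (e : Sym2 X.V)).image fun v =>
          s((Sum.inl v : X.V ⊕ {e : Sym2 X.V // e ∈ X.edges}), Sum.inr e)
  hubs := fun i => Sum.inl (X.hubs i)

private def pfwAux : ℕ → GraphGen
  | 0 => triangle
  | n + 1 => pfwStep (pfwAux n)

/-- `pfw n` is the pseudofractal scale-free web `G_n` (for `n ≥ 1`):
`G_1` is a triangle and `G_{n+1}` is obtained from `G_n` by adding, for each
edge, a new vertex adjacent to both of its endpoints.  Its hubs are the three
vertices of `G_1`. -/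
def pfw (n : ℕ) : GraphGen := pfwAux (n - 1)

/-- The identification relation used to glue three copies of the Sierpinski
graph: `B^(1) ~ A^(2)`, `C^(1) ~ A^(3)`, `C^(2) ~ B^(3)` (copies indexed by
`0, 1, 2` and outmost vertices `A = hubs 0`, `B = hubs 1`, `C = hubs 2`). -/
def sierpRel (X : GraphGen) : Fin 3 × X.V → Fin 3 × X.V → Prop := fun p q =>
  (p = ((0 : Fin 3), X.hubs 1) ∧ q = ((1 : Fin 3), X.hubs 0)) ∨
  (p = ((0 : Fin 3), X.hubs 2) ∧ q = ((2 : Fin 3), X.hubs 0)) ∨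
  (p = ((1 : Fin 3), X.hubs 2) ∧ q = ((2 : Fin 3), X.hubs 1))

/-- One iteration step of the Sierpinski graph: three disjoint copies of the
previous generation are glued along their outmost vertices. -/
def sierpStep (X : GraphGen) : GraphGen where
  V := Quotient (Relation.EqvGen.setoid (sierpRel X))
  fin := inferInstance
  edges :=
    (Finset.univ : Finset (Fin 3)).biUnion fun t =>
      X.edges.image (Sym2.map fun v => Quotient.mk (Relation.EqvGen.setoid (sierpRel X)) (t, v))
  hubs := fun i => Quotient.mk (Relation.EqvGen.setoid (sierpRel X)) (i, X.hubs i)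

private def sierpAux : ℕ → GraphGen
  | 0 => triangle
  | n + 1 => sierpStep (sierpAux n)

/-- `sierp n` is the Sierpinski graph `S_n` (for `n ≥ 1`):
`S_1` is a triangle, and `S_{n+1}` is obtained by gluing three copies of `S_n`
at their outmost vertices.  Its `hubs` are the three outmost vertices. -/
def sierp (n : ℕ) : GraphGen := sierpAux (n - 1)

/-- An edge `e` is dominated by the edge set `F` if it belongs to `F` or
shares an endpoint with some edge of `F`. -/
def Dominated (X : GraphGen) (F : Finset (Sym2 X.V)) (e : Sym2 X.V) : Prop :=
  e ∈ F ∨ ∃ f ∈ F, ∃ v, v ∈ e ∧ v ∈ f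

/-- `F` is an edge dominating set: a set of edges of `X` such that every edge
not in `F` shares an endpoint with some edge of `F`. -/
def IsEDS (X : GraphGen) (F : Finset (Sym2 X.V)) : Prop :=
  F ⊆ X.edges ∧ ∀ e ∈ X.edges, e ∉ F → ∃ f ∈ F, ∃ v, v ∈ e ∧ v ∈ f

/-- The edge domination number: the minimum cardinality of an edge dominating set. -/
def edsNum (X : GraphGen) : ℕ := sInf {k | ∃ F, IsEDS X F ∧ F.card = k}

/-- A minimum edge dominating set: an EDS whose cardinality equals the edge
domination number. -/
def IsMEDS (X : GraphGen) (F : Finset (Sym2 X.V)) : Prop :=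
  IsEDS X F ∧ F.card = edsNum X

/-- Hub number `i` is filled w.r.t. `F`: some edge incident to it lies in `F`. -/
def FilledHub (X : GraphGen) (F : Finset (Sym2 X.V)) (i : Fin 3) : Prop :=
  ∃ f ∈ F, X.hubs i ∈ f

/-- Hub number `i` is cross w.r.t. `F`: no edge incident to it lies in `F` and
some edge incident to it is not dominated by `F`. -/
def CrossHub (X : GraphGen) (F : Finset (Sym2 X.V)) (i : Fin 3) : Prop :=
  ¬ FilledHub X F i ∧ ∃ e ∈ X.edges, X.hubs i ∈ e ∧ ¬ Dominated X F e

/-- Hub number `i` is empty w.r.t. `F`: it is neither filled nor cross. -/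
def EmptyHub (X : GraphGen) (F : Finset (Sym2 X.V)) (i : Fin 3) : Prop :=
  ¬ FilledHub X F i ∧ ¬ CrossHub X F i

/-- `F` is admissible: a set of edges of `X` such that every edge not dominated
by `F` is incident to a cross hub vertex. -/
def Admissible (X : GraphGen) (F : Finset (Sym2 X.V)) : Prop :=
  F ⊆ X.edges ∧
    ∀ e ∈ X.edges, ¬ Dominated X F e → ∃ i, CrossHub X F i ∧ X.hubs i ∈ e

/-- The number of filled hub vertices w.r.t. `F`. -/
def numFilled (X : GraphGen) (F : Finset (Sym2 X.V)) : ℕ :=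
  (Finset.univ.filter fun i : Fin 3 => FilledHub X F i).card

/-- The number of cross hub vertices w.r.t. `F`. -/
def numCross (X : GraphGen) (F : Finset (Sym2 X.V)) : ℕ :=
  (Finset.univ.filter fun i : Fin 3 => CrossHub X F i).card

/-- `minAdm X nf i` is the minimum cardinality of an admissible set with exactly
`nf` filled hub vertices and exactly `i` cross hub vertices. -/
def minAdm (X : GraphGen) (nf i : ℕ) : ℕ :=
  sInf {k | ∃ F, Admissible X F ∧ numFilled X F = nf ∧ numCross X F = i ∧ F.card = k}

/-- The class of admissible sets with exactly `nf` filled and exactly `i` cross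
hub vertices attaining the minimum cardinality among such sets. -/
def admClass (X : GraphGen) (nf i : ℕ) : Set (Finset (Sym2 X.V)) :=
  {F | Admissible X F ∧ numFilled X F = nf ∧ numCross X F = i ∧ F.card = minAdm X nf i}

/-- `a_n^i`: minimum cardinality of an admissible set with no filled hub and `i` cross hubs. -/
def aq (X : GraphGen) (i : ℕ) : ℕ := minAdm X 0 i

/-- `b_n^i`: minimum cardinality of an admissible set with one filled hub and `i` cross hubs. -/
def bq (X : GraphGen) (i : ℕ) : ℕ := minAdm X 1 i

/-- `c_n^i`: minimum cardinality of an admissible set with two filled hubs and `i` cross hubs. -/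
def cq (X : GraphGen) (i : ℕ) : ℕ := minAdm X 2 i

/-- `d_n^i`: minimum cardinality of an admissible set with three filled hubs and `i` cross hubs. -/
def dq (X : GraphGen) (i : ℕ) : ℕ := minAdm X 3 i

end


namespace GraphGen

variable {X : GraphGen}

/-- A vertex of `X`, seen in the next generation. -/
def oldVertex (v : X.V) : (pfwStep X).V := Sum.inl v

/-- The vertex of the next generation attached to an edge of `X`. -/
def newVertex (e : {e : Sym2 X.V // e ∈ X.edges}) : (pfwStep X).V := Sum.inr e

theorem oldVertex_injective : Function.Injective (oldVertex (X := X)) := Sum.inl_injective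

theorem newVertex_injective : Function.Injective (newVertex (X := X)) := Sum.inr_injective

@[simp]
theorem oldVertex_ne_newVertex (v : X.V) (e : {e : Sym2 X.V // e ∈ X.edges}) :
    oldVertex v ≠ newVertex e := Sum.inl_ne_inr

theorem mem_pfwStep_edges {z : Sym2 (pfwStep X).V} :
    z ∈ (pfwStep X).edges ↔
      (∃ e ∈ X.edges, z = e.map oldVertex) ∨
        ∃ e : {e : Sym2 X.V // e ∈ X.edges}, ∃ v ∈ e.1, z = s(oldVertex v, newVertex e) := by
  revert z
  unfold oldVertex newVertex pfwStep
  dsimp only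
  intro z
  simp only [Finset.mem_union, Finset.mem_image, Finset.mem_biUnion, Finset.mem_filter,
    Finset.mem_univ, true_and, Finset.mem_attach, eq_comm (a := z)]

theorem map_oldVertex_mem_edges {e : Sym2 X.V} (he : e ∈ X.edges) :
    e.map oldVertex ∈ (pfwStep X).edges :=
  mem_pfwStep_edges.2 (Or.inl ⟨e, he, rfl⟩)

theorem spoke_mem_edges (e : {e : Sym2 X.V // e ∈ X.edges}) {v : X.V} (hv : v ∈ e.1) :
    s(oldVertex v, newVertex e) ∈ (pfwStep X).edges :=
  mem_pfwStep_edges.2 (Or.inr ⟨e, v, hv, rfl⟩)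

theorem eq_spoke_of_newVertex_mem {z : Sym2 (pfwStep X).V} (hz : z ∈ (pfwStep X).edges)
    {e : {e : Sym2 X.V // e ∈ X.edges}} (he : newVertex e ∈ z) :
    ∃ v ∈ e.1, z = s(oldVertex v, newVertex e) := by
  rcases mem_pfwStep_edges.1 hz with ⟨e', -, rfl⟩ | ⟨e', v, hv, rfl⟩
  · obtain ⟨v, -, h⟩ := Sym2.mem_map.1 he
    exact absurd h (oldVertex_ne_newVertex v e)
  · rcases Sym2.mem_iff.1 he with h | h
    · exact absurd h.symm (oldVertex_ne_newVertex v e)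
    · obtain rfl := newVertex_injective h
      exact ⟨v, hv, rfl⟩

theorem newVertex_mem_unique {z : Sym2 (pfwStep X).V} (hz : z ∈ (pfwStep X).edges)
    {e e' : {e : Sym2 X.V // e ∈ X.edges}} (he : newVertex e ∈ z) (he' : newVertex e' ∈ z) :
    e = e' := by
  obtain ⟨v, -, rfl⟩ := eq_spoke_of_newVertex_mem hz he
  rcases Sym2.mem_iff.1 he' with h | h
  · exact absurd h.symm (oldVertex_ne_newVertex v e')
  · exact (newVertex_injective h).symm

/-- The edges of `X` incident to `u`. -/
noncomputable def incident (X : GraphGen) (u : X.V) : Finset {e : Sym2 X.V // e ∈ X.edges} :=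
  Finset.univ.filter fun e => u ∈ e.1

@[simp]
theorem mem_incident {u : X.V} {e : {e : Sym2 X.V // e ∈ X.edges}} :
    e ∈ X.incident u ↔ u ∈ e.1 := by
  simp [incident]

/-- The degree of an old vertex doubles at each step. -/
theorem two_mul_card_incident_le (u : X.V) :
    2 * (X.incident u).card ≤ ((pfwStep X).incident (oldVertex u)).card := by
  let old : {e : Sym2 X.V // e ∈ X.edges} → {e // e ∈ (pfwStep X).edges} :=
    fun e => ⟨e.1.map oldVertex, map_oldVertex_mem_edges e.2⟩
  let spoke : X.incident u → {e // e ∈ (pfwStep X).edges} :=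
    fun e => ⟨s(oldVertex u, newVertex e.1), spoke_mem_edges e.1 (mem_incident.1 e.2)⟩
  have hold : Function.Injective old := fun a b h =>
    Subtype.ext (Sym2.map.injective oldVertex_injective (congrArg Subtype.val h))
  have hspoke : Function.Injective spoke := fun a b h => by
    have hb : newVertex a.1 ∈ (spoke b).1 := h ▸ Sym2.mem_mk_right _ _
    exact Subtype.ext (newVertex_mem_unique (spoke b).2 hb (Sym2.mem_mk_right _ _))
  have hdisj : Disjoint ((X.incident u).image old) ((X.incident u).attach.image spoke) := by
    rw [Finset.disjoint_left]
    intro z hz hz'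
    obtain ⟨e, -, rfl⟩ := Finset.mem_image.1 hz
    obtain ⟨e', -, h⟩ := Finset.mem_image.1 hz'
    have hmem : newVertex e'.1 ∈ (old e).1 := h ▸ Sym2.mem_mk_right _ _
    obtain ⟨v, -, hv⟩ := Sym2.mem_map.1 hmem
    exact oldVertex_ne_newVertex v _ hv
  calc 2 * (X.incident u).card
      = ((X.incident u).image old ∪ (X.incident u).attach.image spoke).card := by
        rw [Finset.card_union_of_disjoint hdisj, Finset.card_image_of_injective _ hold,
          Finset.card_image_of_injective _ hspoke, Finset.card_attach, two_mul]
    _ ≤ _ := by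
        refine Finset.card_le_card fun z hz => mem_incident.2 ?_
        rcases Finset.mem_union.1 hz with hz | hz
        · obtain ⟨e, he, rfl⟩ := Finset.mem_image.1 hz
          exact Sym2.mem_map.2 ⟨u, mem_incident.1 he, rfl⟩
        · obtain ⟨e, -, rfl⟩ := Finset.mem_image.1 hz
          exact Sym2.mem_mk_left _ _

end GraphGen

open GraphGen

theorem IsEDS.exists_mem {X : GraphGen} {F : Finset (Sym2 X.V)} (hF : IsEDS X F) {e : Sym2 X.V}
    (he : e ∈ X.edges) : ∃ f ∈ F, ∃ v, v ∈ e ∧ v ∈ f := by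
  by_cases h : e ∈ F
  · induction e with
    | _ a b => exact ⟨_, h, a, Sym2.mem_mk_left _ _, Sym2.mem_mk_left _ _⟩
  · exact hF.2 e he h

theorem IsMEDS.card_le {X : GraphGen} {F F' : Finset (Sym2 X.V)} (hF : IsMEDS X F)
    (hF' : IsEDS X F') : F.card ≤ F'.card :=
  hF.2.trans_le (Nat.sInf_le ⟨F', hF', rfl⟩)

/-- The edges of `F` covering the vertices attached to the edges at `u`. -/
noncomputable def spokesAt {X : GraphGen} (F : Finset (Sym2 (pfwStep X).V)) (u : X.V) :
    Finset (Sym2 (pfwStep X).V) :=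
  F.filter fun f => ∃ e ∈ X.incident u, newVertex e ∈ f

theorem card_incident_le_card_spokesAt {X : GraphGen} {F : Finset (Sym2 (pfwStep X).V)}
    (hF : IsEDS (pfwStep X) F) {u : X.V} (hu : ∀ f ∈ F, oldVertex u ∉ f) :
    (X.incident u).card ≤ (spokesAt F u).card := by
  have key : ∀ e ∈ X.incident u, ∃ f ∈ F, newVertex e ∈ f := fun e he => by
    obtain ⟨f, hf, v, hv, hvf⟩ := hF.exists_mem (spoke_mem_edges e (mem_incident.1 he))
    rcases Sym2.mem_iff.1 hv with rfl | rfl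
    · exact absurd hvf (hu f hf)
    · exact ⟨f, hf, hvf⟩
  have : Nonempty (Sym2 (pfwStep X).V) := ⟨s(oldVertex u, oldVertex u)⟩
  choose! g hgF hg using key
  refine Finset.card_le_card_of_injOn g
    (fun e he => Finset.mem_filter.2 ⟨hgF e he, e, he, hg e he⟩) fun e he e' he' h => ?_
  exact newVertex_mem_unique (hF.1 (hgF e he)) (hg e he) (h ▸ hg e' he')

/-- If `u` has at least two incident edges, then two generations later a minimum edge dominating
set covers `u`: otherwise all spokes around `u` could be traded for a matching on the neighbours
of `u` together with a single edge at `u`. -/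
theorem IsMEDS.exists_mem_of_two_le {X : GraphGen} {F : Finset (Sym2 (pfwStep (pfwStep X)).V)}
    (hF : IsMEDS (pfwStep (pfwStep X)) F) {u : X.V} (hu : 2 ≤ (X.incident u).card) :
    ∃ f ∈ F, oldVertex (oldVertex u) ∈ f := by
  by_contra! hcon
  have hother : ∀ e ∈ X.incident u, ∃ v, e.1 = s(u, v) :=
    fun e he => Sym2.mem_iff_exists.1 (mem_incident.1 he)
  have : Nonempty X.V := ⟨u⟩
  choose! o ho using hother
  obtain ⟨e₀, he₀⟩ : (X.incident u).Nonempty := Finset.card_pos.1 (by omega)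
  let μ : {e : Sym2 X.V // e ∈ X.edges} → Sym2 (pfwStep (pfwStep X)).V :=
    fun e => s(oldVertex (oldVertex (o e)), oldVertex (newVertex e))
  let hubEdge : Sym2 (pfwStep (pfwStep X)).V :=
    s(oldVertex (oldVertex u), oldVertex (newVertex e₀))
  let M := insert hubEdge ((X.incident u).image μ)
  let F' := F \ spokesAt F (oldVertex u) ∪ M
  have hMcard : M.card ≤ (X.incident u).card + 1 :=
    (Finset.card_insert_le _ _).trans (Nat.add_le_add_right Finset.card_image_le 1)
  have hMedges : M ⊆ (pfwStep (pfwStep X)).edges := by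
    intro z hz
    rcases Finset.mem_insert.1 hz with rfl | hz
    · exact map_oldVertex_mem_edges (spoke_mem_edges e₀ (mem_incident.1 he₀))
    · obtain ⟨e, he, rfl⟩ := Finset.mem_image.1 hz
      exact map_oldVertex_mem_edges (spoke_mem_edges e (ho e he ▸ Sym2.mem_mk_right _ _))
  have hMcover : ∀ y ∈ (pfwStep X).incident (oldVertex u), ∀ t ∈ y.1,
      ∃ f ∈ M, oldVertex t ∈ f := by
    intro y hy t ht
    by_cases htu : t = oldVertex u
    · exact ⟨hubEdge, Finset.mem_insert_self _ _, htu ▸ Sym2.mem_mk_left _ _⟩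
    have hμ : ∀ e ∈ X.incident u, μ e ∈ M := fun e he =>
      Finset.mem_insert_of_mem (Finset.mem_image_of_mem μ he)
    have hy := mem_incident.1 hy
    rcases mem_pfwStep_edges.1 y.2 with ⟨e, he, hye⟩ | ⟨e, w, hw, hye⟩
    · rw [hye] at hy ht
      obtain ⟨u', hu', h⟩ := Sym2.mem_map.1 hy
      obtain rfl := oldVertex_injective h
      obtain ⟨v, hv, rfl⟩ := Sym2.mem_map.1 ht
      have hinc : (⟨e, he⟩ : {e : Sym2 X.V // e ∈ X.edges}) ∈ X.incident u' := mem_incident.2 hu'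
      rw [show e = _ from ho _ hinc] at hv
      rcases Sym2.mem_iff.1 hv with rfl | rfl
      · exact absurd rfl htu
      · exact ⟨_, hμ _ hinc, Sym2.mem_mk_left _ _⟩
    · rw [hye] at hy ht
      rcases Sym2.mem_iff.1 hy with h | h
      · obtain rfl := oldVertex_injective h
        rcases Sym2.mem_iff.1 ht with rfl | rfl
        · exact absurd rfl htu
        · exact ⟨_, hμ e (mem_incident.2 hw), Sym2.mem_mk_right _ _⟩
      · exact absurd h (oldVertex_ne_newVertex _ _)
  have hF' : IsEDS (pfwStep (pfwStep X)) F' := by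
    refine ⟨Finset.union_subset (Finset.sdiff_subset.trans hF.1.1) hMedges, fun z hz _ => ?_⟩
    have hcov : ∀ y ∈ (pfwStep X).incident (oldVertex u), ∀ t ∈ y.1, oldVertex t ∈ z →
        ∃ f ∈ F', ∃ v, v ∈ z ∧ v ∈ f := fun y hy t ht htz => by
      obtain ⟨f, hf, htf⟩ := hMcover y hy t ht
      exact ⟨f, Finset.mem_union_right _ hf, _, htz, htf⟩
    obtain ⟨f, hf, v, hvz, hvf⟩ := hF.1.exists_mem hz
    by_cases hfR : f ∈ spokesAt F (oldVertex u)
    · obtain ⟨y, hy, hyf⟩ := (Finset.mem_filter.1 hfR).2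
      obtain ⟨t, ht, rfl⟩ := eq_spoke_of_newVertex_mem (hF.1.1 hf) hyf
      rcases Sym2.mem_iff.1 hvf with rfl | rfl
      · exact hcov y hy t ht hvz
      · obtain ⟨t', ht', rfl⟩ := eq_spoke_of_newVertex_mem hz hvz
        exact hcov y hy t' ht' (Sym2.mem_mk_left _ _)
    · exact ⟨f, Finset.mem_union_left _ (Finset.mem_sdiff.2 ⟨hf, hfR⟩), v, hvz, hvf⟩
  have hle := hF.card_le hF'
  have hunion : F'.card ≤ (F \ spokesAt F (oldVertex u)).card + M.card := Finset.card_union_le _ _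
  have hsub : (F \ spokesAt F (oldVertex u)).card + (spokesAt F (oldVertex u)).card = F.card :=
    Finset.card_sdiff_add_card_eq_card (Finset.filter_subset _ _)
  have hspokes := card_incident_le_card_spokesAt hF.1 hcon
  have hdeg := two_mul_card_incident_le u
  omega

theorem two_le_card_incident_hub (m : ℕ) (i : Fin 3) :
    2 ≤ ((pfwAux m).incident ((pfwAux m).hubs i)).card := by
  induction m with
  | zero =>
    have hmem : ∀ j k : Fin 3, j ≠ k → s(j, k) ∈ triangle.edges := by
      change ∀ j k : Fin 3, j ≠ k →
        s(j, k) ∈ ({s(0, 1), s(0, 2), s(1, 2)} : Finset (Sym2 (Fin 3)))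
      decide
    refine Nat.succ_le_of_lt (Finset.one_lt_card.2
      ⟨⟨s(i, i + 1), hmem _ _ (by revert i; decide)⟩, mem_incident.2 (Sym2.mem_mk_left _ _),
        ⟨s(i, i + 2), hmem _ _ (by revert i; decide)⟩, mem_incident.2 (Sym2.mem_mk_left _ _), ?_⟩)
    intro h
    have h' : i + 1 = i + 2 := Sym2.congr_right.1 (congrArg Subtype.val h)
    exact absurd h' (by clear h h'; revert i; decide)
  | succ m ih =>
    have h := two_mul_card_incident_le ((pfwAux m).hubs i)
    change 2 ≤ ((pfwStep (pfwAux m)).incident (oldVertex ((pfwAux m).hubs i))).card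
    omega

/-- for every `n ≥ 3`, every minimum edge dominating set of the
pseudofractal scale-free web `G_n` contains, for each of the three hub vertices,
at least one edge incident to that hub vertex. -/
theorem pfw_MEDS_hubs_filled (n : ℕ) (hn : 3 ≤ n) :
    ∀ F, IsMEDS (pfw n) F → ∀ i : Fin 3, ∃ f ∈ F, (pfw n).hubs i ∈ f := by
  obtain ⟨m, rfl⟩ := Nat.exists_eq_add_of_le' hn
  intro F hF i
  exact IsMEDS.exists_mem_of_two_le (X := pfwAux m) hF (two_le_card_incident_hub m i)
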